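/- Let W be a standard Brownian motion, S_t = S₀ exp((μ - σ²/2) t + σ W_t) with S₀ > 0, σ ≠ 0, and set F_t = S_t - S₀ e^{μ t}. Then for every T > 0 the random variable ∫₀^T F_τ dτ has strictly positive variance; in particular it is not almost surely equal to 0. -/

import Mathlib

open MeasureTheory ProbabilityTheory Real

variable {Ω : Type*} [MeasureSpace Ω]

/-- `W` is a standard Brownian motion: measurable marginals, starts at `0`,
continuous sample paths, Gaussian increments `W_t - W_s ~ N(0, t-s)`, and
independent increments over disjoint intervals. -/
structure IsStandardBrownianMotion (W : ℝ → Ω → ℝ) : Prop where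
  meas : ∀ t : ℝ, Measurable (W t)
  init : ∀ᵐ ω ∂(ℙ : Measure Ω), W 0 ω = 0
  cont : ∀ᵐ ω ∂(ℙ : Measure Ω), Continuous fun t => W t ω
  incr : ∀ s t : ℝ, 0 ≤ s → s ≤ t →
    Measure.map (fun ω => W t ω - W s ω) ℙ = gaussianReal 0 (Real.toNNReal (t - s))
  indep : ∀ s t u v : ℝ, 0 ≤ s → s ≤ t → t ≤ u → u ≤ v →
    IndepFun (fun ω => W t ω - W s ω) (fun ω => W v ω - W u ω) ℙ

theorem sq_integral_le_measureReal_mul_integral_sq {α : Type*} [MeasurableSpace α]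
    {ν : Measure α} [IsFiniteMeasure ν] {f : α → ℝ} (hf : MemLp f 2 ν) :
    (∫ a, f a ∂ν) ^ 2 ≤ ν.real Set.univ * ∫ a, f a ^ 2 ∂ν := by
  set c := ν.real Set.univ with hc
  set I := ∫ a, f a ∂ν with hI
  have hf1 : Integrable f ν := hf.integrable one_le_two
  have hf2 : Integrable (fun a => f a ^ 2) ν := hf.integrable_sq
  have expand : ∫ a, (c * f a - I) ^ 2 ∂ν = c * (c * ∫ a, f a ^ 2 ∂ν - I ^ 2) := by
    have h : (fun a => (c * f a - I) ^ 2)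
        = fun a => (c ^ 2 * f a ^ 2 - 2 * c * I * f a) + I ^ 2 := by
      ext a; ring
    have hdiff : Integrable (fun a => c ^ 2 * f a ^ 2 - 2 * c * I * f a) ν :=
      (hf2.const_mul _).sub (hf1.const_mul _)
    rw [h, integral_add hdiff (integrable_const _),
      integral_sub (hf2.const_mul _) (hf1.const_mul _), integral_const_mul, integral_const_mul,
      integral_const, ← hI, ← hc, smul_eq_mul]
    ring
  have hnonneg : 0 ≤ c * (c * ∫ a, f a ^ 2 ∂ν - I ^ 2) :=
    expand ▸ integral_nonneg fun a => sq_nonneg _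
  rcases (measureReal_nonneg : 0 ≤ ν.real Set.univ).eq_or_lt with h0 | hpos
  · have hν : ν = 0 := by
      rw [← Measure.measure_univ_eq_zero, ← measureReal_eq_zero_iff]
      exact h0.symm
    simp [hI, hν]
  · linarith [nonneg_of_mul_nonneg_right hnonneg hpos]

theorem MeasureTheory.MemLp.integral_prod_two {α β : Type*} [MeasurableSpace α]
    [MeasurableSpace β] {ν : Measure α} {P : Measure β} [IsFiniteMeasure ν] [SFinite P]
    {f : α × β → ℝ} (hf : MemLp f 2 (ν.prod P)) :
    MemLp (fun b => ∫ a, f (a, b) ∂ν) 2 P := by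
  have hm : AEStronglyMeasurable (fun b => ∫ a, f (a, b) ∂ν) P := hf.1.prod_swap.integral_prod_right'
  have hsq := hf.integrable_sq
  rw [memLp_two_iff_integrable_sq hm]
  refine (hsq.integral_prod_right.const_mul (ν.real Set.univ)).mono' (hm.pow 2) ?_
  filter_upwards [hsq.prod_left_ae, hf.1.prod_swap.prodMk_left] with b hb hbm
  rw [Real.norm_of_nonneg (sq_nonneg _)]
  exact sq_integral_le_measureReal_mul_integral_sq ((memLp_two_iff_integrable_sq hbm).2 hb)

/-- A time integral that is positively correlated with some square integrable variable is not
almost surely constant. -/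
theorem variance_integral_pos_of_integral_mul_pos {α β : Type*} [MeasurableSpace α]
    [MeasurableSpace β] {ν : Measure α} {P : Measure β} [IsFiniteMeasure ν] [IsProbabilityMeasure P]
    {f : α × β → ℝ} (hf : MemLp f 2 (ν.prod P)) {Z : β → ℝ} (hZ : MemLp Z 2 P)
    (hZ0 : ∫ b, Z b ∂P = 0) (hpos : 0 < ∫ a, ∫ b, f (a, b) * Z b ∂P ∂ν) :
    0 < variance (fun b => ∫ a, f (a, b) ∂ν) P := by
  refine (variance_nonneg _ _).lt_of_ne' fun hvar => hpos.ne' ?_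
  have hconst := ae_eq_integral_of_variance_eq_zero hf.integral_prod_two hvar
  have hint : Integrable (fun p : α × β => f p * Z p.2) (ν.prod P) :=
    hf.integrable_mul (hZ.comp_snd ν)
  rw [integral_integral_swap (f := fun a b => f (a, b) * Z b) hint]
  simp_rw [integral_mul_const]
  rw [integral_congr_ae (hconst.mono fun b hb => congrArg (· * Z b) hb), integral_const_mul, hZ0,
    mul_zero]

namespace IsStandardBrownianMotion

variable {W : ℝ → Ω → ℝ}

theorem exists_continuous_version (hW : IsStandardBrownianMotion W) :
    ∃ V : ℝ → Ω → ℝ, IsStandardBrownianMotion V ∧ (∀ ω, Continuous fun t => V t ω) ∧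
      ∀ᵐ ω ∂(ℙ : Measure Ω), ∀ t, W t ω = V t ω := by
  classical
  obtain ⟨s, hs, hsm, hs0⟩ := exists_measurable_superset_of_null (ae_iff.1 hW.cont)
  have hsc : ∀ ω, ω ∉ s → Continuous fun t => W t ω := fun ω hω => by
    by_contra h
    exact hω (hs h)
  let V : ℝ → Ω → ℝ := fun t => s.piecewise (fun _ => 0) (W t)
  have hVW : ∀ᵐ ω ∂(ℙ : Measure Ω), ∀ t, W t ω = V t ω := by
    filter_upwards [compl_mem_ae_iff.2 hs0] with ω hω t
    simp only [V]
    rw [Set.piecewise_eq_of_notMem _ _ _ hω]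
  have hVc : ∀ ω, Continuous fun t => V t ω := fun ω => by
    by_cases hω : ω ∈ s
    · simpa only [V, Set.piecewise_eq_of_mem _ _ _ hω] using continuous_const
    · simpa only [V, Set.piecewise_eq_of_notMem _ _ _ hω] using hsc ω hω
  have hincr : ∀ a b, (fun ω => W b ω - W a ω) =ᵐ[ℙ] fun ω => V b ω - V a ω := fun a b => by
    filter_upwards [hVW] with ω h
    rw [h, h]
  refine ⟨V, ⟨fun t => measurable_const.piecewise hsm (hW.meas t), ?_, .of_forall hVc, ?_, ?_⟩,
    hVc, hVW⟩
  · filter_upwards [hW.init, hVW] with ω h0 h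
    rw [← h, h0]
  · intro a b ha hab
    rw [← Measure.map_congr (hincr a b), hW.incr a b ha hab]
  · intro a b c d ha hab hbc hcd
    exact (hW.indep a b c d ha hab hbc hcd).congr (hincr a b) (hincr c d)

theorem integral_exp_mul_sub (hW : IsStandardBrownianMotion W) {s t : ℝ} (hs : 0 ≤ s)
    (hst : s ≤ t) (c : ℝ) :
    ∫ ω, rexp (c * (W t ω - W s ω)) ∂ℙ = rexp (c ^ 2 * (t - s) / 2) := by
  have h := mgf_gaussianReal (hW.incr s t hs hst) c
  rw [mgf, Real.coe_toNNReal _ (sub_nonneg.2 hst)] at h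
  rw [h]
  ring_nf

theorem ae_eq_sub_zero (hW : IsStandardBrownianMotion W) :
    ∀ᵐ ω ∂(ℙ : Measure Ω), ∀ t, W t ω = W t ω - W 0 ω := by
  filter_upwards [hW.init] with ω h t
  rw [h, sub_zero]

theorem integral_exp_add_mul (hW : IsStandardBrownianMotion W) {t : ℝ} (ht : 0 ≤ t) (a c : ℝ) :
    ∫ ω, rexp (a + c * W t ω) ∂ℙ = rexp (a + c ^ 2 * t / 2) := by
  have h := hW.integral_exp_mul_sub le_rfl ht c
  rw [sub_zero] at h
  simp_rw [Real.exp_add]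
  rw [integral_const_mul, ← h]
  congr 1
  refine integral_congr_ae ?_
  filter_upwards [hW.ae_eq_sub_zero] with ω h
  rw [← h]

theorem integrable_exp_add_mul (hW : IsStandardBrownianMotion W) {t : ℝ} (ht : 0 ≤ t) (a c : ℝ) :
    Integrable (fun ω => rexp (a + c * W t ω)) ℙ := by
  refine .of_integral_ne_zero ?_
  rw [hW.integral_exp_add_mul ht]
  exact (Real.exp_pos _).ne'

theorem memLp_two_exp_add_mul (hW : IsStandardBrownianMotion W) {t : ℝ} (ht : 0 ≤ t) (a c : ℝ) :
    MemLp (fun ω => rexp (a + c * W t ω)) 2 ℙ := by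
  have hm := hW.meas t
  rw [memLp_two_iff_integrable_sq (by fun_prop)]
  convert hW.integrable_exp_add_mul ht (2 * a) (2 * c) using 2 with ω
  rw [← Real.exp_nat_mul]
  push_cast
  ring_nf

theorem integral_exp_mul_exp (hW : IsStandardBrownianMotion W) {s t : ℝ} (hs : 0 ≤ s)
    (hst : s ≤ t) (a b c : ℝ) :
    ∫ ω, rexp (a + c * W s ω) * rexp (b + c * W t ω) ∂ℙ
      = rexp (a + b + c ^ 2 * (3 * s + t) / 2) := by
  have hms := hW.meas s
  have hmt := hW.meas t
  have hm0 := hW.meas 0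
  have hind := (hW.indep 0 s s t le_rfl hs le_rfl hst).comp
    (φ := fun x => rexp (2 * c * x)) (ψ := fun x => rexp (c * x)) (by fun_prop) (by fun_prop)
  have hmul := hind.integral_fun_mul_eq_mul_integral (by fun_prop) (by fun_prop)
  simp only [Function.comp_apply] at hmul
  rw [hW.integral_exp_mul_sub le_rfl hs, hW.integral_exp_mul_sub hs hst] at hmul
  calc ∫ ω, rexp (a + c * W s ω) * rexp (b + c * W t ω) ∂ℙ
      = ∫ ω, rexp (a + b) * (rexp (2 * c * (W s ω - W 0 ω)) * rexp (c * (W t ω - W s ω))) ∂ℙ := by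
        refine integral_congr_ae ?_
        filter_upwards [hW.ae_eq_sub_zero] with ω h
        rw [← h, ← Real.exp_add, ← Real.exp_add, ← Real.exp_add]
        ring_nf
    _ = rexp (a + b + c ^ 2 * (3 * s + t) / 2) := by
        rw [integral_const_mul, hmul, ← Real.exp_add, ← Real.exp_add]
        ring_nf

theorem memLp_two_prod_exp [IsProbabilityMeasure (ℙ : Measure Ω)]
    (hW : IsStandardBrownianMotion W) (hc : ∀ ω, Continuous fun t => W t ω) (a c T : ℝ) :
    MemLp (fun p : ℝ × Ω => rexp (a * p.1 + c * W p.1 p.2)) 2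
      ((volume.restrict (Set.Ioc 0 T)).prod ℙ) := by
  have hm : Measurable (fun p : ℝ × Ω => W p.1 p.2) :=
    measurable_uncurry_of_continuous_of_measurable hc hW.meas
  have hm' : Measurable (fun p : ℝ × Ω => rexp (a * p.1 + c * W p.1 p.2)) := by fun_prop
  have hmem : ∀ᵐ t ∂(volume.restrict (Set.Ioc 0 T)), t ∈ Set.Ioc 0 T :=
    ae_restrict_mem measurableSet_Ioc
  rw [memLp_two_iff_integrable_sq hm'.aestronglyMeasurable,
    integrable_prod_iff (hm'.pow_const 2).aestronglyMeasurable]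
  have hsq : ∀ t ω, rexp (a * t + c * W t ω) ^ 2 = rexp (2 * (a * t) + 2 * c * W t ω) := by
    intro t ω
    rw [← Real.exp_nat_mul]
    push_cast
    ring_nf
  simp only [hsq, Real.norm_eq_abs, Real.abs_exp]
  constructor
  · filter_upwards [hmem] with t ht using hW.integrable_exp_add_mul ht.1.le _ _
  · have hcont : Continuous fun t : ℝ => rexp (2 * (a * t) + (2 * c) ^ 2 * t / 2) := by fun_prop
    refine (hcont.integrableOn_Ioc (a := 0) (b := T)).congr ?_
    filter_upwards [hmem] with t ht using (hW.integral_exp_add_mul ht.1.le _ _).symm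

end IsStandardBrownianMotion

/-- Geometric Brownian motion does not oscillate around its mean `S₀ e^{μt}`:
the time integral of the deviation `F_t = S_t - S₀ e^{μt}` over `[0,T]` has
strictly positive variance; in particular it is not a.s. equal to `0`. -/
theorem gbm_not_fluctuating_around_mean
    [IsProbabilityMeasure (ℙ : Measure Ω)]
    (W : ℝ → Ω → ℝ) (hW : IsStandardBrownianMotion W)
    (S₀ μ σ : ℝ) (hS₀ : 0 < S₀) (hσ : σ ≠ 0)
    (T : ℝ) (hT : 0 < T) :
    0 < variance (fun ω => ∫ τ in (0:ℝ)..T,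
          (S₀ * Real.exp ((μ - σ ^ 2 / 2) * τ + σ * W τ ω) - S₀ * Real.exp (μ * τ))) ℙ
    ∧ ¬ (∀ᵐ ω ∂(ℙ : Measure Ω),
          (∫ τ in (0:ℝ)..T,
            (S₀ * Real.exp ((μ - σ ^ 2 / 2) * τ + σ * W τ ω) - S₀ * Real.exp (μ * τ))) = 0) := by
  have variance_pos : 0 < variance (fun ω => ∫ τ in (0:ℝ)..T,
      (S₀ * Real.exp ((μ - σ ^ 2 / 2) * τ + σ * W τ ω) - S₀ * Real.exp (μ * τ))) ℙ := by
    obtain ⟨V, hV, hVc, hWV⟩ := hW.exists_continuous_version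
    let F : ℝ × Ω → ℝ := fun p =>
      S₀ * rexp ((μ - σ ^ 2 / 2) * p.1 + σ * V p.1 p.2) - S₀ * rexp (μ * p.1)
    let Z : Ω → ℝ := fun ω => rexp ((μ - σ ^ 2 / 2) * T + σ * V T ω) - rexp (μ * T)
    have heq : (fun ω => ∫ τ in (0:ℝ)..T,
        (S₀ * Real.exp ((μ - σ ^ 2 / 2) * τ + σ * W τ ω) - S₀ * Real.exp (μ * τ)))
        =ᵐ[ℙ] fun ω => ∫ τ in Set.Ioc 0 T, F (τ, ω) := by
      filter_upwards [hWV] with ω h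
      simp only [h, F, intervalIntegral.integral_of_le hT.le]
    have hdet : MemLp (fun t : ℝ => S₀ * rexp (μ * t)) 2 (volume.restrict (Set.Ioc 0 T)) := by
      have hcont : Continuous fun t : ℝ => (S₀ * rexp (μ * t)) ^ 2 := by fun_prop
      exact (memLp_two_iff_integrable_sq (by fun_prop)).2 hcont.integrableOn_Ioc
    have hF : MemLp F 2 ((volume.restrict (Set.Ioc 0 T)).prod ℙ) :=
      ((hV.memLp_two_prod_exp hVc _ σ T).const_mul S₀).sub (hdet.comp_fst ℙ)
    have hmean : ∀ t, 0 ≤ t → ∫ ω, rexp ((μ - σ ^ 2 / 2) * t + σ * V t ω) ∂ℙ = rexp (μ * t) := by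
      intro t ht
      rw [hV.integral_exp_add_mul ht]
      ring_nf
    have hZ : MemLp Z 2 ℙ := (hV.memLp_two_exp_add_mul hT.le _ σ).sub (memLp_const _)
    have hZ0 : ∫ ω, Z ω ∂ℙ = 0 := by
      simp only [Z]
      rw [integral_sub (hV.integrable_exp_add_mul hT.le _ _) (integrable_const _), hmean T hT.le]
      simp
    have hcov : ∀ t ∈ Set.Ioc 0 T, ∫ ω, F (t, ω) * Z ω ∂ℙ
        = S₀ * rexp (μ * (t + T)) * (rexp (σ ^ 2 * t) - 1) := by
      intro t ht
      have hG := hV.memLp_two_exp_add_mul ht.1.le ((μ - σ ^ 2 / 2) * t) σ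
      have hH := hV.memLp_two_exp_add_mul hT.le ((μ - σ ^ 2 / 2) * T) σ
      have hsplit : ∀ ω, F (t, ω) * Z ω
          = S₀ * (rexp ((μ - σ ^ 2 / 2) * t + σ * V t ω) * rexp ((μ - σ ^ 2 / 2) * T + σ * V T ω))
            - S₀ * rexp (μ * T) * rexp ((μ - σ ^ 2 / 2) * t + σ * V t ω)
            - S₀ * rexp (μ * t) * Z ω := fun ω => by
        simp only [F, Z]
        ring
      have hGH : Integrable (fun ω => S₀ * (rexp ((μ - σ ^ 2 / 2) * t + σ * V t ω)
          * rexp ((μ - σ ^ 2 / 2) * T + σ * V T ω))) ℙ := (hG.integrable_mul hH).const_mul S₀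
      have hG' := (hG.integrable one_le_two).const_mul (S₀ * rexp (μ * T))
      simp_rw [hsplit]
      rw [integral_sub (by exact hGH.sub hG') ((hZ.integrable one_le_two).const_mul _),
        integral_sub hGH hG', integral_const_mul, integral_const_mul, integral_const_mul, hZ0,
        hmean t ht.1.le, hV.integral_exp_mul_exp ht.1.le ht.2,
        show (μ - σ ^ 2 / 2) * t + (μ - σ ^ 2 / 2) * T + σ ^ 2 * (3 * t + T) / 2
          = μ * t + μ * T + σ ^ 2 * t by ring, mul_add, Real.exp_add, Real.exp_add]
      ring
    rw [variance_congr heq]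
    refine variance_integral_pos_of_integral_mul_pos hF hZ hZ0 ?_
    rw [setIntegral_congr_fun measurableSet_Ioc hcov, ← intervalIntegral.integral_of_le hT.le]
    refine intervalIntegral.intervalIntegral_pos_of_pos_on
      (Continuous.intervalIntegrable (by fun_prop) _ _) (fun t ht => ?_) hT
    have hexp : 1 < rexp (σ ^ 2 * t) := Real.one_lt_exp_iff.2 (mul_pos (by positivity) ht.1)
    exact mul_pos (by positivity) (sub_pos.2 hexp)
  refine ⟨variance_pos, fun h => variance_pos.ne' ?_⟩
  rw [variance_congr (Y := 0) h, variance_zero]
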